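/- (Positive principal eigenvalue for large patches when 0<c<c*.) Assume (H1) and (EXP). Fix r,q,L₀>0, fix a C¹ nonincreasing function ρ:ℝ→[0,1] with ρ(x)=1 for x≤0 and ρ(x)=0 for x≥1, and let c satisfy 0 < c < c*, where c* := inf_{μ>0} (∫_ℝ e^{−μ z} k(z) dz − 1 + r)/μ. For L>0 set a_L(ξ) = −q + (r+q)·ρ((|ξ|−L)/L₀). Then there exists L̄>0 such that for every L ≥ L̄ there exist λ>0 and a bounded C¹ function φ:ℝ→(0,∞) satisfying c φ'(ξ)+∫_ℝ k(η−ξ) φ(η) dη − φ(ξ) + a_L(ξ) φ(ξ) = λ φ(ξ) for all ξ∈ℝ. -/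

import Mathlib

open MeasureTheory Real Set Filter Topology

noncomputable section

/-- Hypothesis (H1) on the kernel `k`. -/
def H1 (k : ℝ → ℝ) : Prop :=
  ContDiff ℝ 1 k ∧ (∀ z, 0 ≤ k z) ∧ (∀ z, k (-z) = k z) ∧
  (∫ z, k z) = 1 ∧ 0 < k 0 ∧
  ∃ μ M : ℝ, 0 < μ ∧ 0 < M ∧ ∀ z, M < |z| →
    k z < Real.exp (-(μ * |z|)) ∧ |deriv k z| < Real.exp (-(μ * |z|))

/-- Hypothesis (EXP): all exponential moments of `k` are finite. -/
def EXPk (k : ℝ → ℝ) : Prop :=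
  ∀ μ : ℝ, MeasureTheory.Integrable (fun z => Real.exp (μ * z) * k z)

/-- Hypothesis (H2) on the cut-off function `χ`. -/
def IsH2chi (r q L L0 : ℝ) (χ : ℝ → ℝ) : Prop :=
  0 < r ∧ 0 < q ∧ 0 < L ∧ 0 < L0 ∧
  ContDiff ℝ 1 χ ∧ (∀ x, χ x ∈ Set.Icc (0:ℝ) 1) ∧
  (∀ x, χ (-x) = χ x) ∧ (∀ x, |x| ≤ L → χ x = 1) ∧
  (∀ x, L + L0 ≤ |x| → χ x = 0) ∧ AntitoneOn χ (Set.Ici 0)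

/-- The growth function of hypothesis (H2). -/
def fH2 (r q : ℝ) (χ : ℝ → ℝ) : ℝ → ℝ → ℝ :=
  fun x u => -q + (r * (1 - u) + q) * χ x

/-- A bounded positive traveling-wave profile for speed `c`, kernel `k`, growth `f`. -/
def IsTW (c : ℝ) (k : ℝ → ℝ) (f : ℝ → ℝ → ℝ) (Φ : ℝ → ℝ) : Prop :=
  ContDiff ℝ 1 Φ ∧ (∀ ξ, 0 < Φ ξ) ∧ (∃ C, ∀ ξ, Φ ξ ≤ C) ∧
  ∀ ξ, c * deriv Φ ξ + ((∫ η, k (η - ξ) * Φ η) - Φ ξ) + f ξ (Φ ξ) * Φ ξ = 0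

/-- A bounded classical solution of equation (E) on `[0,∞) × ℝ`, with partial
derivatives `vt` (in time) and `vx` (in space). -/
def IsClassicalSol (c : ℝ) (k : ℝ → ℝ) (f : ℝ → ℝ → ℝ) (v vt vx : ℝ → ℝ → ℝ) : Prop :=
  (∃ C, ∀ t ξ, 0 ≤ t → |v t ξ| ≤ C) ∧
  ContinuousOn (fun p : ℝ × ℝ => v p.1 p.2) {p : ℝ × ℝ | 0 ≤ p.1} ∧
  ContinuousOn (fun p : ℝ × ℝ => vt p.1 p.2) {p : ℝ × ℝ | 0 ≤ p.1} ∧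
  ContinuousOn (fun p : ℝ × ℝ => vx p.1 p.2) {p : ℝ × ℝ | 0 ≤ p.1} ∧
  (∀ t ξ, 0 ≤ t → HasDerivWithinAt (fun s => v s ξ) (vt t ξ) (Set.Ici 0) t) ∧
  (∀ t ξ, 0 ≤ t → HasDerivAt (fun y => v t y) (vx t ξ) ξ) ∧
  (∀ t ξ, 0 ≤ t →
    vt t ξ = c * vx t ξ + ((∫ η, k (η - ξ) * v t η) - v t ξ) + f ξ (v t ξ) * v t ξ)

/-- The spreading speed `c*` of the homogeneous equation with growth rate `r`. -/
def cstar (k : ℝ → ℝ) (r : ℝ) : ℝ :=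
  sInf {y : ℝ | ∃ μ : ℝ, 0 < μ ∧ y = ((∫ z, Real.exp (-(μ * z)) * k z) - 1 + r) / μ}



structure IsCone {E : Type*} [NormedAddCommGroup E] [NormedSpace ℝ E] (C : Set E) : Prop where
  closed : IsClosed C
  zero : 0 ∈ C
  add : ∀ x ∈ C, ∀ y ∈ C, x + y ∈ C
  smul : ∀ d : ℝ, 0 ≤ d → ∀ x ∈ C, d • x ∈ C

def PosOp {E : Type*} [NormedAddCommGroup E] [NormedSpace ℝ E] (C : Set E) (T : E →L[ℝ] E) : Prop :=
  ∀ f ∈ C, T f ∈ C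

section cone
variable {E : Type*} [NormedAddCommGroup E] [NormedSpace ℝ E] {C : Set E}

lemma PosOp.mul' {A B : E →L[ℝ] E} (hA : PosOp C A) (hB : PosOp C B) : PosOp C (A * B) :=
  fun f hf => hA _ (hB f hf)

lemma PosOp.add' {A B : E →L[ℝ] E} (hC : IsCone C) (hA : PosOp C A) (hB : PosOp C B) : PosOp C (A + B) :=
  fun f hf => hC.add _ (hA f hf) _ (hB f hf)

lemma PosOp.smul' {A : E →L[ℝ] E} (hC : IsCone C) (hA : PosOp C A) {d : ℝ} (hd : 0 ≤ d) : PosOp C (d • A) :=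
  fun f hf => hC.smul _ hd _ (hA f hf)

lemma PosOp.pow' {A : E →L[ℝ] E} (hA : PosOp C A) (n : ℕ) : PosOp C (A ^ n) := by
  induction n with
  | zero => intro f hf; simpa using hf
  | succ n ih => rw [pow_succ]; exact ih.mul' hA

lemma neumann [CompleteSpace E] (hC : IsCone C) (A : E →L[ℝ] E) (hA : ‖A‖ < 1) (hp : PosOp C A) :
    ∃ N : E →L[ℝ] E, PosOp C N ∧ N * (1 - A) = 1 ∧ (1 - A) * N = 1 := by
  have hs : Summable (fun n : ℕ => A ^ n) := summable_geometric_of_norm_lt_one hA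
  refine ⟨∑' n, A ^ n, ?_, geom_series_mul_neg A hA, mul_neg_geom_series A hA⟩
  intro f hf
  have h1 := hs.hasSum
  have h2 := (ContinuousLinearMap.apply ℝ E f).hasSum h1
  refine hC.closed.mem_of_tendsto h2 (Eventually.of_forall fun t => ?_)
  induction t using Finset.induction_on with
  | empty => simpa using hC.zero
  | insert a t ha ih =>
    rw [Finset.sum_insert ha]
    exact hC.add _ (hp.pow' a f hf) _ ih

def GoodS (C : Set E) (T S : E →L[ℝ] E) (σ : ℝ) : Prop :=
  ∃ R : E →L[ℝ] E, PosOp C R ∧ R * (1 - (T + σ • S)) = 1 ∧ (1 - (T + σ • S)) * R = 1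

lemma good_open [CompleteSpace E] (hC : IsCone C) {T S R : E →L[ℝ] E} {σ d : ℝ} (hS : PosOp C S) (hR : PosOp C R)
    (h1 : R * (1 - (T + σ • S)) = 1) (h2 : (1 - (T + σ • S)) * R = 1) (hd : 0 ≤ d)
    (hlt : d * ‖R * S‖ < 1) : GoodS C T S (σ + d) := by
  obtain ⟨N, hN, n1, n2⟩ := neumann hC (d • (R * S))
    (by rw [norm_smul, Real.norm_of_nonneg hd]; exact hlt) ((hR.mul' hS).smul' hC hd)
  have key : (1 - (T + (σ + d) • S)) = (1 - (T + σ • S)) * (1 - d • (R * S)) := by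
    rw [mul_sub, mul_one, mul_smul_comm, ← mul_assoc, h2, one_mul, add_smul]; abel
  refine ⟨N * R, hN.mul' hR, ?_, ?_⟩
  · rw [key, mul_assoc, ← mul_assoc R, h1, one_mul, n1]
  · rw [key, mul_assoc, ← mul_assoc _ N, n2, one_mul, h2]

theorem blowup [CompleteSpace E] (hC : IsCone C) (e : E) (he : e ∈ C) (hne : ‖e‖ ≤ 1)
    (hen : ∀ A : E →L[ℝ] E, PosOp C A → ‖A‖ ≤ ‖A e‖)
    (T S : E →L[ℝ] E) (hT : PosOp C T) (hS : PosOp C S) (h0 : ‖T‖ < 1)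
    (σm : ℝ) (hσm : 0 ≤ σm) (w : E) (hw : -w ∉ C)
    (hsub : (T + σm • S) w - w ∈ C) :
    ∃ s : ℝ, 0 ≤ s ∧ s ≤ σm ∧ ∃ v : ℕ → E, (∀ n, v n ∈ C) ∧ (∀ n, ‖v n‖ = 1) ∧
      Tendsto (fun n => v n - (T + s • S) (v n)) atTop (𝓝 0) := by
  have hP0 : GoodS C T S 0 := by
    obtain ⟨N, hN, n1, n2⟩ := neumann hC T h0 hT
    exact ⟨N, hN, by simpa using n1, by simpa using n2⟩
  have hPm : ¬ GoodS C T S σm := by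
    rintro ⟨R, hR, h1, h2⟩
    have h3 := hR _ hsub
    have h4 : R ((T + σm • S) w - w) = - w := by
      have := congrArg (fun A : E →L[ℝ] E => A w) h1
      simp only [mul_apply_eq_comp, sub_apply,
        one_apply_eq_self] at this
      rw [← neg_sub, map_neg, this]
    rw [h4] at h3
    exact hw h3
  set B := {σ : ℝ | 0 ≤ σ ∧ ¬ GoodS C T S σ} with hB
  have hBb : BddBelow B := ⟨0, fun σ h => h.1⟩
  have hBm : σm ∈ B := ⟨hσm, hPm⟩
  set s := sInf B with hs
  have hs0 : 0 ≤ s := le_csInf ⟨_, hBm⟩ (fun σ h => h.1)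
  have hsm : s ≤ σm := csInf_le hBb hBm
  have hPs : ¬ GoodS C T S s := by
    rintro ⟨R, hR, h1, h2⟩
    have hpos : 0 < 1 / (‖R * S‖ + 1) := by positivity
    obtain ⟨σ, hσ, hlt⟩ := exists_lt_of_csInf_lt ⟨_, hBm⟩ (show sInf B < s + 1 / (‖R * S‖ + 1) by linarith)
    have hge : s ≤ σ := csInf_le hBb hσ
    apply hσ.2
    have := good_open hC (d := σ - s) hS hR h1 h2 (by linarith) (by
      have : (σ - s) * (‖R * S‖ + 1) < 1 := by
        rw [← lt_div_iff₀ (by positivity)]; linarith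
      nlinarith)
    simpa using this
  have hspos : 0 < s := lt_of_le_of_ne hs0 (fun h => hPs (h ▸ hP0))
  have hex : ∀ n : ℕ, ∃ v : E, v ∈ C ∧ ‖v‖ = 1 ∧
      ‖v - (T + s • S) v‖ ≤ 2 * (s / (n + 1)) * ‖S‖ := by
    intro n
    set d := s / ((n : ℝ) + 1) with hd
    have hdpos : 0 < d := by positivity
    have hds : d ≤ s := div_le_self hs0 (by linarith [(Nat.cast_nonneg n : (0:ℝ) ≤ n)])
    have hg : GoodS C T S (s - d) := by
      by_contra h
      have := csInf_le hBb (show s - d ∈ B from ⟨by linarith, h⟩)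
      linarith
    obtain ⟨R, hR, h1, h2⟩ := hg
    have hbig : 1 ≤ d * ‖R * S‖ := by
      by_contra h
      push Not at h
      have := good_open hC (d := d) hS hR h1 h2 hdpos.le h
      rw [sub_add_cancel] at this
      exact hPs this
    have hbig2 : 1 ≤ d * (‖R e‖ * ‖S‖) := by
      refine hbig.trans (mul_le_mul_of_nonneg_left ?_ hdpos.le)
      exact (norm_mul_le _ _).trans (mul_le_mul_of_nonneg_right (hen R hR) (norm_nonneg _))
    have hupos : 0 < ‖R e‖ := by
      rcases (norm_nonneg (R e)).eq_or_lt with h | h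
      · rw [← h] at hbig2; simp at hbig2; linarith
      · exact h
    have hnv : ‖(‖R e‖⁻¹ • R e)‖ = 1 := by
      rw [norm_smul, norm_inv, norm_norm, inv_mul_cancel₀ hupos.ne']
    refine ⟨‖R e‖⁻¹ • R e, ?_, hnv, ?_⟩
    · exact hC.smul _ (by positivity) _ (hR e he)
    · set v := ‖R e‖⁻¹ • R e with hv
      have e1 : v - (T + (s - d) • S) v = ‖R e‖⁻¹ • e := by
        have := congrArg (fun A : E →L[ℝ] E => A e) h2
        simp only [mul_apply_eq_comp, sub_apply,
          one_apply_eq_self] at this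
        rw [hv, map_smul, ← smul_sub, this]
      have e2 : v - (T + s • S) v = ‖R e‖⁻¹ • e - d • S v := by
        rw [← e1]
        simp only [add_apply, smul_apply]
        module
      rw [e2]
      have b1 : ‖(‖R e‖⁻¹ • e)‖ ≤ d * ‖S‖ := by
        rw [norm_smul, norm_inv, norm_norm]
        rw [inv_mul_le_iff₀ hupos]
        linarith
      have b2 : ‖d • S v‖ ≤ d * ‖S‖ := by
        rw [norm_smul, Real.norm_of_nonneg hdpos.le]
        refine mul_le_mul_of_nonneg_left ?_ hdpos.le
        have := S.le_opNorm v
        rwa [hnv, mul_one] at this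
      linarith [norm_sub_le (‖R e‖⁻¹ • e) (d • S v)]
  choose v hv0 hv1 hv2 using hex
  refine ⟨s, hs0, hsm, v, hv0, hv1, ?_⟩
  apply squeeze_zero_norm hv2
  have : Tendsto (fun n : ℕ => 2 * (s * (1 / ((n : ℝ) + 1))) * ‖S‖) atTop (𝓝 (2 * (s * 0) * ‖S‖)) :=
    ((tendsto_one_div_add_atTop_nhds_zero_nat.const_mul s).const_mul 2).mul_const _
  simpa [div_eq_mul_inv] using this

theorem eigen_abs [CompleteSpace E] (hC : IsCone C) (e : E) (he : e ∈ C) (hne : ‖e‖ ≤ 1)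
    (hen : ∀ A : E →L[ℝ] E, PosOp C A → ‖A‖ ≤ ‖A e‖)
    (S K B : E →L[ℝ] E) (hS : PosOp C S) (hK : PosOp C K) (hB : PosOp C B)
    (h0 : ‖S * (K + B)‖ < 1) (σm : ℝ) (hσm : 0 ≤ σm)
    (h1 : ∀ s, 0 ≤ s → s ≤ σm → ‖S * K + s • S‖ < 1)
    (hcomp : ∀ (f : ℕ → E) (M : ℝ), (∀ n, ‖f n‖ ≤ M) →
      ∃ θ : ℕ → ℕ, StrictMono θ ∧ ∃ g, Tendsto (fun n => B (S (f (θ n)))) atTop (𝓝 g))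
    (w : E) (hw : -w ∉ C) (hsub : S (K w + B w + σm • w) - w ∈ C) :
    ∃ s : ℝ, 0 ≤ s ∧ s ≤ σm ∧ ∃ v ∈ C, ‖v‖ = 1 ∧ v = S (K v + B v + s • v) := by
  have hT : ∀ (s : ℝ) (v : E), (S * (K + B) + s • S) v = S (K v + B v + s • v) := by
    intro s v; simp
  obtain ⟨s, hs0, hsm, v, hv0, hv1, hv2⟩ := blowup hC e he hne hen (S * (K + B)) S
    (hS.mul' (hK.add' hC hB)) hS h0 σm hσm w hw (by rw [hT]; exact hsub)
  refine ⟨s, hs0, hsm, ?_⟩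
  obtain ⟨N, hN, n1, n2⟩ := neumann hC (S * K + s • S) (h1 s hs0 hsm)
    ((hS.mul' hK).add' hC (hS.smul' hC hs0))
  simp only [hT] at hv2
  obtain ⟨θ, hθ, g, hg⟩ := hcomp (fun n => K (v n) + B (v n) + s • v n)
    (‖K‖ + ‖B‖ + s) (fun n => by
      have a1 := K.le_opNorm (v n)
      have a2 := B.le_opNorm (v n)
      have a3 : ‖s • v n‖ = s := by rw [norm_smul, hv1, Real.norm_of_nonneg hs0, mul_one]
      rw [hv1, mul_one] at a1 a2
      exact (norm_add₃_le).trans (by linarith))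
  have hv3 := hv2.comp hθ.tendsto_atTop
  have hBv : Tendsto (fun n => B (v (θ n))) atTop (𝓝 g) := by
    have := ((B.continuous.tendsto 0).comp hv3).add hg
    simp only [map_zero, zero_add] at this
    refine this.congr (fun n => ?_)
    simp
  have hvlim : Tendsto (fun n => v (θ n)) atTop (𝓝 (N (S g))) := by
    have h2 := (N.continuous.tendsto _).comp
      (((S.continuous.tendsto g).comp hBv).add hv3)
    rw [add_zero] at h2
    refine h2.congr (fun n => ?_)
    have h3 := congrArg (fun A : E →L[ℝ] E => A (v (θ n))) n1
    simp only [mul_apply_eq_comp, one_apply_eq_self] at h3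
    rw [← h3]
    simp only [Function.comp]
    congr 1
    simp
    abel
  set u := N (S g) with hu
  refine ⟨u, ?_, ?_, ?_⟩
  · exact hC.closed.mem_of_tendsto hvlim (Eventually.of_forall fun n => hv0 _)
  · have := hvlim.norm
    simp only [hv1] at this
    exact (tendsto_nhds_unique this tendsto_const_nhds)
  · have hc : Continuous (fun v => v - S (K v + B v + s • v)) := by fun_prop
    have := tendsto_nhds_unique ((hc.tendsto u).comp hvlim) hv3
    exact sub_eq_zero.mp this

end cone


abbrev EE := BoundedContinuousFunction ℝ ℝ

lemma EE.abs_le (f : EE) (x : ℝ) : |f x| ≤ ‖f‖ := f.norm_coe_le_norm x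

lemma avg_integrable {w : ℝ → ℝ} (hw : Integrable w) (f : EE) (x : ℝ) :
    Integrable (fun z => w z * f (x + z)) := by
  refine hw.mul_bdd (c := ‖f‖) ?_ ?_
  · exact (f.continuous.comp (by fun_prop)).aestronglyMeasurable
  · exact Eventually.of_forall fun z => f.norm_coe_le_norm _

lemma avg_bound {w : ℝ → ℝ} (hw : Integrable w) (f : EE) (x : ℝ) :
    ‖∫ z, w z * f (x + z)‖ ≤ (∫ z, |w z|) * ‖f‖ := by
  rw [← integral_mul_const]
  refine norm_integral_le_of_norm_le (hw.abs.mul_const _) (Eventually.of_forall fun z => ?_)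
  rw [norm_mul]
  exact mul_le_mul_of_nonneg_left (f.norm_coe_le_norm _) (norm_nonneg _)

def avgFun (w : ℝ → ℝ) (hw : Integrable w) (f : EE) : EE :=
  BoundedContinuousFunction.ofNormedAddCommGroup (fun x => ∫ z, w z * f (x + z))
    (by
      refine continuous_of_dominated (bound := fun z => |w z| * ‖f‖) ?_ ?_ ?_ ?_
      · intro x; exact (avg_integrable hw f x).aestronglyMeasurable
      · intro x
        refine Eventually.of_forall fun z => ?_
        rw [norm_mul]
        exact mul_le_mul_of_nonneg_left (f.norm_coe_le_norm _) (norm_nonneg _)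
      · exact hw.abs.mul_const _
      · refine Eventually.of_forall fun z => ?_
        exact continuous_const.mul (f.continuous.comp (by fun_prop)))
    ((∫ z, |w z|) * ‖f‖) (avg_bound hw f)

def avg (w : ℝ → ℝ) (hw : Integrable w) : EE →L[ℝ] EE :=
  LinearMap.mkContinuous
    { toFun := avgFun w hw
      map_add' := by
        intro f g; ext x
        change ∫ z, w z * (f (x + z) + g (x + z)) = (∫ z, w z * f (x + z)) + ∫ z, w z * g (x + z)
        rw [← integral_add (avg_integrable hw f x) (avg_integrable hw g x)]
        simp only [mul_add]
      map_smul' := by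
        intro c f; ext x
        change ∫ z, w z * (c * f (x + z)) = c * (∫ z, w z * f (x + z))
        rw [← integral_const_mul]
        congr 1; ext z; ring }
    (∫ z, |w z|) (by
      intro f
      change ‖avgFun w hw f‖ ≤ _
      rw [BoundedContinuousFunction.norm_le (by positivity)]
      exact avg_bound hw f)

lemma avg_apply (w : ℝ → ℝ) (hw : Integrable w) (f : EE) (x : ℝ) :
    avg w hw f x = ∫ z, w z * f (x + z) := rfl

lemma avg_norm (w : ℝ → ℝ) (hw : Integrable w) : ‖avg w hw‖ ≤ ∫ z, |w z| :=
  LinearMap.mkContinuous_norm_le _ (by positivity) _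

/-- weight of the resolvent -/
def sw (c γ : ℝ) : ℝ → ℝ := (Ioi (0:ℝ)).indicator (fun z => (1 / c) * exp (-γ * z))

lemma sw_int (c γ : ℝ) (hγ : 0 < γ) : Integrable (sw c γ) := by
  unfold sw
  rw [integrable_indicator_iff measurableSet_Ioi]
  exact (integrableOn_exp_mul_Ioi (by linarith) 0).const_mul _

lemma sw_nonneg (c γ : ℝ) (hc : 0 < c) (z : ℝ) : 0 ≤ sw c γ z := by
  unfold sw
  apply indicator_nonneg
  intro z _; positivity

lemma sw_integral (c γ : ℝ) (hγ : 0 < γ) : ∫ z, sw c γ z = 1 / (c * γ) := by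
  unfold sw
  rw [integral_indicator measurableSet_Ioi, integral_const_mul, integral_exp_mul_Ioi (by linarith)]
  simp; ring

lemma sw_apply (c γ : ℝ) (hγ : 0 < γ) (f : EE) (x : ℝ) :
    avg (sw c γ) (sw_int c γ hγ) f x = ∫ z in Ioi 0, (1 / c) * exp (-γ * z) * f (x + z) := by
  rw [avg_apply, ← integral_indicator measurableSet_Ioi]
  congr 1; ext z
  unfold sw
  by_cases h : z ∈ Ioi (0:ℝ) <;> simp [h]

lemma sw_apply' (c γ : ℝ) (hγ : 0 < γ) (f : EE) (x : ℝ) :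
    avg (sw c γ) (sw_int c γ hγ) f x = (1 / c) * exp (γ * x) * ∫ y in Ioi x, exp (-γ * y) * f y := by
  rw [sw_apply c γ hγ]
  rw [← integral_const_mul, ← integral_indicator measurableSet_Ioi,
    ← integral_indicator measurableSet_Ioi,
    ← integral_add_left_eq_self ((Ioi x).indicator _) x]
  congr 1; ext z
  simp only [indicator, mem_Ioi, lt_add_iff_pos_right]
  split_ifs with hz
  swap
  · rfl
  rw [show -γ * (x + z) = -γ * x + -γ * z by ring, exp_add]
  have : exp (γ * x) * exp (-γ * x) = 1 := by rw [← exp_add]; simp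
  linear_combination -(1 / c * exp (-γ * z) * f (x + z)) * this

lemma exp_mul_EE_int (γ : ℝ) (hγ : 0 < γ) (f : EE) (x : ℝ) :
    IntegrableOn (fun y => exp (-γ * y) * f y) (Ioi x) := by
  refine Integrable.mul_bdd (c := ‖f‖) (integrableOn_exp_mul_Ioi (by linarith) x) ?_ ?_
  · exact f.continuous.aestronglyMeasurable
  · exact Eventually.of_forall fun z => f.norm_coe_le_norm _

lemma sw_deriv (c γ : ℝ) (hc : 0 < c) (hγ : 0 < γ) (f : EE) (x : ℝ) :
    HasDerivAt (avg (sw c γ) (sw_int c γ hγ) f)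
      ((c * γ * avg (sw c γ) (sw_int c γ hγ) f x - f x) / c) x := by
  set g : ℝ → ℝ := fun y => exp (-γ * y) * f y with hg
  have hgc : Continuous g := by
    have := f.continuous
    fun_prop
  have e : (avg (sw c γ) (sw_int c γ hγ) f : ℝ → ℝ) = fun x => (1 / c) * exp (γ * x) *
      ((∫ y in Ioi 0, g y) - ∫ y in (0:ℝ)..x, g y) := by
    ext x
    rw [sw_apply' c γ hγ, ← intervalIntegral.integral_Ioi_sub_Ioi' (exp_mul_EE_int γ hγ f 0)
      (exp_mul_EE_int γ hγ f x), sub_sub_cancel]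
  have h1 : HasDerivAt (fun x => ∫ y in (0:ℝ)..x, g y) (g x) x :=
    intervalIntegral.integral_hasDerivAt_right (hgc.intervalIntegrable _ _)
      (hgc.stronglyMeasurableAtFilter _ _) hgc.continuousAt
  have h2 : HasDerivAt (fun x => (1 / c) * exp (γ * x)) ((1 / c) * (exp (γ * x) * (γ * 1))) x :=
    (((hasDerivAt_id x).const_mul γ).exp).const_mul _
  have h3 := h2.mul (h1.const_sub (∫ y in Ioi 0, g y))
  rw [e]
  refine h3.congr_deriv ?_
  have : exp (γ * x) * exp (-γ * x) = 1 := by rw [← exp_add]; simp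
  simp only [hg]
  have hc' : c⁻¹ * c = 1 := inv_mul_cancel₀ hc.ne'
  simp only [div_eq_mul_inv]
  linear_combination (-f x * c⁻¹) * this + (-γ * c⁻¹ * exp (γ * x) * ((∫ y in Ioi 0, exp (-γ * y) * f y) - ∫ y in (0:ℝ)..x, exp (-γ * y) * f y)) * hc'

lemma sw_lip (c γ : ℝ) (hc : 0 < c) (hγ : 0 < γ) (f : EE) (x y : ℝ) :
    |avg (sw c γ) (sw_int c γ hγ) f x - avg (sw c γ) (sw_int c γ hγ) f y| ≤ (2 * ‖f‖ / c) * |x - y| := by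
  have key := Convex.norm_image_sub_le_of_norm_hasDerivWithin_le (𝕜 := ℝ)
    (f := avg (sw c γ) (sw_int c γ hγ) f) (s := univ) (C := 2 * ‖f‖ / c) (x := y) (y := x)
    (fun z _ => (sw_deriv c γ hc hγ f z).hasDerivWithinAt) (fun z _ => ?_) convex_univ (mem_univ _) (mem_univ _)
  · exact key
  · have h1 : |avg (sw c γ) (sw_int c γ hγ) f z| ≤ 1 / (c * γ) * ‖f‖ := by
      have := avg_bound (sw_int c γ hγ) f z
      simp only [abs_of_nonneg (sw_nonneg c γ hc _), sw_integral c γ hγ] at this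
      exact this
    have h2 := f.abs_le z
    rw [norm_div, Real.norm_eq_abs, Real.norm_of_nonneg hc.le]
    gcongr
    have h3 : |c * γ * avg (sw c γ) (sw_int c γ hγ) f z| ≤ ‖f‖ := by
      rw [abs_mul, abs_of_pos (by positivity : 0 < c * γ)]
      calc _ ≤ c * γ * (1 / (c * γ) * ‖f‖) := by gcongr
        _ = ‖f‖ := by field_simp
    exact (abs_sub _ _).trans (by linarith)

lemma compact_seq (b : EE) (R : ℝ) (hb : ∀ x, R < |x| → b x = 0) (c γ : ℝ) (hc : 0 < c) (hγ : 0 < γ)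
    (f : ℕ → EE) (M : ℝ) (hf : ∀ n, ‖f n‖ ≤ M) :
    ∃ θ : ℕ → ℕ, StrictMono θ ∧ ∃ g, Tendsto (fun n => b * avg (sw c γ) (sw_int c γ hγ) (f (θ n)))
      atTop (𝓝 g) := by
  set S := avg (sw c γ) (sw_int c γ hγ) with hS
  have hM : 0 ≤ M := (norm_nonneg _).trans (hf 0)
  let F : ℕ → BoundedContinuousFunction (Icc (-R) R) ℝ := fun n =>
    (S (f n)).compContinuous ⟨Subtype.val, continuous_subtype_val⟩
  have hF : ∀ n x, F n x = S (f n) x := fun n x => rfl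
  have hcpt : IsCompact (closure (range F)) := by
    refine BoundedContinuousFunction.arzela_ascoli (Metric.closedBall 0 (‖S‖ * M)) (isCompact_closedBall _ _) _ ?_ ?_
    · rintro g x ⟨n, rfl⟩
      rw [mem_closedBall_zero_iff, hF]
      exact ((S (f n)).norm_coe_le_norm x).trans ((S.le_opNorm _).trans (by gcongr; exact hf n))
    · refine Metric.equicontinuous_of_continuity_modulus (fun t => (2 * M / c) * t) ?_ _ ?_
      · have : Continuous (fun t : ℝ => (2 * M / c) * t) := by fun_prop
        simpa using this.tendsto 0
      · rintro x y ⟨_, n, rfl⟩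
        change dist (F n x) (F n y) ≤ _
        rw [hF, hF, Real.dist_eq, Subtype.dist_eq, Real.dist_eq]
        refine (sw_lip c γ hc hγ (f n) x y).trans ?_
        gcongr
        exact hf n
  obtain ⟨G, -, θ, hθ, hG⟩ := hcpt.tendsto_subseq (fun n => subset_closure (mem_range_self n))
  refine ⟨θ, hθ, ?_⟩
  apply cauchySeq_tendsto_of_complete
  have hGc := hG.cauchySeq
  rw [Metric.cauchySeq_iff] at hGc ⊢
  intro ε hε
  obtain ⟨N, hN⟩ := hGc (ε / (‖b‖ + 1)) (by positivity)
  refine ⟨N, fun m hm n hn => ?_⟩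
  have h1 := hN m hm n hn
  refine lt_of_le_of_lt ((BoundedContinuousFunction.dist_le (C := ‖b‖ * dist (F (θ m)) (F (θ n))) (by positivity)).2 fun x => ?_) ?_
  · rw [BoundedContinuousFunction.mul_apply, BoundedContinuousFunction.mul_apply, Real.dist_eq, ← mul_sub, abs_mul]
    by_cases hx : R < |x|
    · rw [hb x hx]; simp; positivity
    · push Not at hx
      have h2 := BoundedContinuousFunction.dist_coe_le_dist (f := F (θ m)) (g := F (θ n)) ⟨x, abs_le.1 hx⟩
      rw [hF, hF, Real.dist_eq] at h2
      gcongr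
      exact b.abs_le x
  · have h3 : dist (F (θ m)) (F (θ n)) * (‖b‖ + 1) < ε := (lt_div_iff₀ (by positivity)).1 h1
    have h4 : 0 ≤ dist (F (θ m)) (F (θ n)) := dist_nonneg
    nlinarith

lemma sw_inv (c γ : ℝ) (hc : 0 < c) (hγ : 0 < γ) (u h : EE) (du : ℝ → ℝ)
    (hu : ∀ x, HasDerivAt u (du x) x) (hh : ∀ x, h x = c * γ * u x - c * du x) :
    avg (sw c γ) (sw_int c γ hγ) h = u := by
  ext x
  rw [sw_apply' c γ hγ]
  have h1 : ∫ y in Ioi x, -(1 / c) * (exp (-γ * y) * h y) = 0 - exp (-γ * x) * u x := by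
    refine integral_Ioi_of_hasDerivAt_of_tendsto' (f := fun y => exp (-γ * y) * u y) ?_ ?_ ?_
    · intro y _
      have := (((hasDerivAt_id y).const_mul (-γ)).exp).mul (hu y)
      refine this.congr_deriv ?_
      rw [hh]
      simp only [id]
      field_simp
      ring
    · exact (exp_mul_EE_int γ hγ h x).const_mul _
    · have h2 : Tendsto (fun y => exp (-γ * y) * ‖u‖) atTop (𝓝 (0 * ‖u‖)) := by
        refine Tendsto.mul_const _ (Real.tendsto_exp_atBot.comp ?_)
        exact tendsto_id.const_mul_atTop_of_neg (by linarith)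
      rw [zero_mul] at h2
      refine squeeze_zero_norm (fun y => ?_) h2
      rw [norm_mul, Real.norm_of_nonneg (exp_pos _).le]
      gcongr
      exact u.norm_coe_le_norm y
  rw [integral_const_mul] at h1
  have : exp (γ * x) * exp (-γ * x) = 1 := by rw [← exp_add]; simp
  linear_combination (-exp (γ * x)) * h1 + u x * this


lemma max_sq_deriv (t : ℝ) : HasDerivAt (fun t : ℝ => (max t 0) ^ 2) (2 * max t 0) t := by
  have hne : ∀ t : ℝ, t ≠ 0 → HasDerivAt (fun t : ℝ => (max t 0) ^ 2) (2 * max t 0) t := by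
    intro t ht
    rcases lt_or_gt_of_ne ht with h | h
    · rw [max_eq_right h.le, mul_zero]
      refine (hasDerivAt_const t (0:ℝ)).congr_of_eventuallyEq ?_
      filter_upwards [eventually_lt_nhds h] with s hs
      simp [max_eq_right hs.le]
    · rw [max_eq_left h.le]
      have := (hasDerivAt_id t).pow 2
      refine (this.congr_deriv (by simp)).congr_of_eventuallyEq ?_
      filter_upwards [eventually_gt_nhds h] with s hs
      simp [max_eq_left hs.le]
  by_cases ht : t = 0
  · subst ht
    refine hasDerivAt_of_hasDerivAt_of_ne (fun y hy => hne y hy) ?_ ?_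
    · fun_prop
    · fun_prop
  · exact hne t ht

def HH (y : ℝ) : ℝ := (max (1 - y ^ 2) 0) ^ 2
def HH' (y : ℝ) : ℝ := -(4 * y * max (1 - y ^ 2) 0)

lemma HH_deriv (y : ℝ) : HasDerivAt HH (HH' y) y := by
  have h1 : HasDerivAt (fun y : ℝ => 1 - y ^ 2) (-(2 * y)) y := by
    have := ((hasDerivAt_id y).pow 2).const_sub 1
    exact this.congr_deriv (by simp)
  have := (max_sq_deriv (1 - y ^ 2)).comp y h1
  refine this.congr_deriv ?_
  unfold HH'; ring

lemma HH_cont : Continuous HH := by unfold HH; fun_prop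
lemma HH'_cont : Continuous HH' := by unfold HH'; fun_prop
lemma HH_nonneg (y : ℝ) : 0 ≤ HH y := by unfold HH; positivity
lemma HH_le (y : ℝ) : HH y ≤ 1 := by
  unfold HH
  have : max (1 - y ^ 2) 0 ≤ 1 := max_le (by nlinarith) (by norm_num)
  have h0 : 0 ≤ max (1 - y ^ 2) 0 := le_max_right _ _
  nlinarith
lemma HH_out {y : ℝ} (h : 1 ≤ |y|) : HH y = 0 ∧ HH' y = 0 := by
  have : max (1 - y ^ 2) 0 = 0 := max_eq_right (by nlinarith [sq_abs y, abs_nonneg y])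
  simp [HH, HH', this]
lemma HH_in {y : ℝ} (h : |y| ≤ 1) : HH y = (1 - y ^ 2) ^ 2 ∧ HH' y = -(4 * y * (1 - y ^ 2)) := by
  have : max (1 - y ^ 2) 0 = 1 - y ^ 2 := max_eq_left (by nlinarith [sq_abs y, abs_nonneg y])
  simp [HH, HH', this]
lemma HH_even (y : ℝ) : HH (-y) = HH y ∧ HH' (-y) = - HH' y := by
  simp [HH, HH']

def DD (y s : ℝ) : ℝ := HH (y + s) - HH y - s * HH' y

lemma DD_even (y s : ℝ) : DD (-y) (-s) = DD y s := by
  unfold DD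
  rw [show -y + -s = -(y + s) by ring, (HH_even _).1, (HH_even y).1, (HH_even y).2]; ring

lemma DD_out {y : ℝ} (h : 1 ≤ |y|) (s : ℝ) : 0 ≤ DD y s := by
  unfold DD
  rw [(HH_out h).1, (HH_out h).2]
  simpa using HH_nonneg _

lemma DD_int {y : ℝ} (h : |y| ≤ 1) (s : ℝ) : -(5 * s ^ 2) ≤ DD y s := by
  unfold DD
  rw [(HH_in h).1, (HH_in h).2]
  have hp : 0 ≤ 1 - y ^ 2 := by nlinarith [sq_abs y, abs_nonneg y]
  rcases le_total |y + s| 1 with h1 | h1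
  · rw [(HH_in h1).1]
    have : 0 ≤ s ^ 2 * (3 + 2 * y ^ 2 + (2 * y + s) ^ 2) := by positivity
    nlinarith
  · rw [(HH_out h1).1]
    have h2 : 1 ≤ (y + s) ^ 2 := by nlinarith [sq_abs (y + s)]
    rcases le_or_gt 0 (s * y) with h3 | h3
    · have : (1 - y ^ 2) ≤ 2 * (s * y) + s ^ 2 := by nlinarith
      have h5 : 0 ≤ (1 - y ^ 2) * (2 * (s * y) + s ^ 2 - (1 - y ^ 2)) := mul_nonneg hp (by linarith)
      have h6 : 0 ≤ (1 - y ^ 2) * (s * y) := mul_nonneg hp h3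
      nlinarith [mul_nonneg (sq_nonneg y) (sq_nonneg s), sq_nonneg s]
    · have hs : 1 ≤ s ^ 2 := by
        have hy := abs_le.1 h
        rcases mul_neg_iff.1 h3 with ⟨a, b⟩ | ⟨a, b⟩
        · rcases le_abs.1 h1 with h4 | h4 <;> nlinarith
        · rcases le_abs.1 h1 with h4 | h4 <;> nlinarith
      have hsy : - s ^ 2 ≤ s * y := by nlinarith [sq_nonneg y, sq_nonneg (s + y), sq_nonneg s]
      have h6 : 0 ≤ (1 - y ^ 2) * (s * y + s ^ 2) := mul_nonneg hp (by linarith)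
      nlinarith [mul_nonneg (sq_nonneg y) (sq_nonneg s), sq_nonneg s, mul_nonneg hp (sq_nonneg y)]

lemma DD_right {y : ℝ} (h1 : 9 / 10 ≤ y) (h2 : y ≤ 1) (s : ℝ) :
    2 * (if s < 0 then s ^ 2 else 0) - 4 * |s| ^ 3 ≤ DD y s := by
  have h : |y| ≤ 1 := abs_le.2 ⟨by linarith, h2⟩
  unfold DD
  rw [(HH_in h).1, (HH_in h).2]
  have hp : 0 ≤ 1 - y ^ 2 := by nlinarith
  split_ifs with hs
  · rw [abs_of_neg hs]
    rcases le_total (-1) (y + s) with h3 | h3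
    · rw [(HH_in (abs_le.2 ⟨h3, by linarith⟩)).1]
      have e : (1 - (y + s) ^ 2) ^ 2 - (1 - y ^ 2) ^ 2 - s * -(4 * y * (1 - y ^ 2))
        - (2 * s ^ 2 - 4 * (-s) ^ 3) = s ^ 2 * ((6 * y ^ 2 - 4) + 4 * (y - 1) * s + s ^ 2) := by ring
      have : 0 ≤ s ^ 2 * ((6 * y ^ 2 - 4) + 4 * (y - 1) * s + s ^ 2) := by
        apply mul_nonneg (sq_nonneg _)
        nlinarith
      linarith
    · rw [(HH_out (by rw [abs_of_nonpos (by linarith)]; linarith)).1]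
      have hs2 : 19 / 10 ≤ -s := by linarith
      have q1 : (1 - y ^ 2) ^ 2 ≤ 1 := by nlinarith
      have q2 : (-s) * (4 * y * (1 - y ^ 2)) ≤ (-s) * 4 := by
        apply mul_le_mul_of_nonneg_left _ (by linarith)
        nlinarith
      have q3 : (-s) ^ 2 * (19 / 10) ≤ (-s) ^ 3 := by nlinarith [sq_nonneg s]
      nlinarith
  · push Not at hs
    have : 0 ≤ |s| ^ 3 := by positivity
    suffices 0 ≤ HH (y + s) - (1 - y ^ 2) ^ 2 - s * -(4 * y * (1 - y ^ 2)) by linarith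
    rcases le_total (y + s) 1 with h3 | h3
    · rw [(HH_in (abs_le.2 ⟨by linarith, h3⟩)).1]
      have e : (1 - (y + s) ^ 2) ^ 2 - (1 - y ^ 2) ^ 2 - s * -(4 * y * (1 - y ^ 2))
        = s ^ 2 * ((6 * y ^ 2 - 2) + 4 * y * s + s ^ 2) := by ring
      rw [e]
      apply mul_nonneg (sq_nonneg _)
      nlinarith [mul_nonneg (by linarith : (0:ℝ) ≤ y) hs]
    · rw [(HH_out (by rw [abs_of_nonneg (by linarith)]; linarith)).1]
      have : 0 ≤ (1 - y ^ 2) * (4 * s * y - (1 - y ^ 2)) := mul_nonneg hp (by nlinarith)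
      nlinarith

lemma DD_left {y : ℝ} (h1 : -1 ≤ y) (h2 : y ≤ -(9 / 10)) (s : ℝ) :
    2 * (if 0 < s then s ^ 2 else 0) - 4 * |s| ^ 3 ≤ DD y s := by
  have := DD_right (y := -y) (by linarith) (by linarith) (-s)
  rw [DD_even] at this
  simpa using this

lemma kernel_test (κ : ℝ → ℝ) (hκ : Continuous κ) (hκ0 : ∀ z, 0 ≤ κ z) (hκp : 0 < κ 0)
    (hint : ∀ n : ℕ, Integrable (fun z => |z| ^ n * κ z)) (δ : ℝ) (hδ : 0 < δ) :
    ∃ ε : ℝ, 0 < ε ∧ ∀ y, 0 ≤ δ * HH y + ∫ z, κ z * DD y (ε * z) := by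
  have hint2 : Integrable (fun z => z ^ 2 * κ z) := by simpa using hint 2
  have hposs : ∀ s : Set ℝ, MeasurableSet s → (∀ a : ℝ, 0 < a → ∃ z ∈ interior s, |z| < a ∧ z ≠ 0) →
      0 < ∫ z, κ z * s.indicator (fun z => z ^ 2) z := by
    intro s hs hsa
    have e : (fun z => κ z * s.indicator (fun z => z ^ 2) z) = s.indicator (fun z => z ^ 2 * κ z) := by
      ext z; by_cases h : z ∈ s <;> simp [h, mul_comm]
    rw [e, integral_pos_iff_support_of_nonneg]
    · obtain ⟨a, ha, hball⟩ := Metric.eventually_nhds_iff.1 (hκ.continuousAt.eventually (eventually_gt_nhds hκp))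
      obtain ⟨z0, hz0, hz1, hz2⟩ := hsa a ha
      have hop : IsOpen (interior s ∩ {z | 0 < z ^ 2 * κ z}) :=
        isOpen_interior.inter (isOpen_lt continuous_const (by fun_prop))
      refine lt_of_lt_of_le (hop.measure_pos volume ⟨z0, hz0, ?_⟩) (measure_mono ?_)
      · have := hball (y := z0) (by simpa using hz1)
        simp only [mem_ofPred_eq]
        positivity
      · rintro z ⟨h1, h2⟩
        rw [Function.mem_support, indicator_of_mem (interior_subset h1)]
        exact (show 0 < z ^ 2 * κ z from h2).ne'
    · intro z
      exact indicator_nonneg (fun z _ => mul_nonneg (sq_nonneg _) (hκ0 z)) z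
    · exact hint2.indicator hs
  have hpL := hposs (Iio 0) measurableSet_Iio (fun a ha => ⟨-(a / 2), by
    rw [interior_Iio]; exact ⟨by simp; linarith, by rw [abs_neg, abs_of_pos (by linarith)]; linarith, by linarith⟩⟩)
  have hpR := hposs (Ioi 0) measurableSet_Ioi (fun a ha => ⟨(a / 2), by
    rw [interior_Ioi]; exact ⟨by simp; linarith, by rw [abs_of_pos (by linarith)]; linarith, by linarith⟩⟩)
  have iI : ∀ s : Set ℝ, MeasurableSet s → Integrable (fun z => κ z * s.indicator (fun z => z ^ 2) z) := by
    intro s hs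
    have e : (fun z => κ z * s.indicator (fun z => z ^ 2) z) = s.indicator (fun z => z ^ 2 * κ z) := by
      ext z; by_cases h : z ∈ s <;> simp [h, mul_comm]
    rw [e]; exact hint2.indicator hs
  set mL := ∫ z, κ z * (Iio (0:ℝ)).indicator (fun z => z ^ 2) z
  set mR := ∫ z, κ z * (Ioi (0:ℝ)).indicator (fun z => z ^ 2) z
  set m2 := ∫ z, z ^ 2 * κ z
  set m3 := ∫ z, |z| ^ 3 * κ z
  have hev : ∀ᶠ ε in 𝓝[>] (0:ℝ), 5 * ε ^ 2 * m2 < δ * (36 / 1000) ∧ 4 * ε * m3 < 2 * mL ∧ 4 * ε * m3 < 2 * mR := by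
    refine nhdsWithin_le_nhds ?_
    have t1 : Tendsto (fun ε : ℝ => 5 * ε ^ 2 * m2) (𝓝 0) (𝓝 (5 * 0 ^ 2 * m2)) :=
      Continuous.tendsto (by fun_prop) _
    have t2 : Tendsto (fun ε : ℝ => 4 * ε * m3) (𝓝 0) (𝓝 (4 * 0 * m3)) :=
      Continuous.tendsto (by fun_prop) _
    filter_upwards [t1.eventually (eventually_lt_nhds (by simp; positivity : _ < δ * (36 / 1000))),
      t2.eventually (eventually_lt_nhds (by simpa using hpL : _ < 2 * mL)),
      t2.eventually (eventually_lt_nhds (by simpa using hpR : _ < 2 * mR))] with ε a b c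
    exact ⟨a, b, c⟩
  obtain ⟨ε, ⟨e1, e2, e3⟩, hε⟩ := (hev.and self_mem_nhdsWithin).exists
  refine ⟨ε, hε, fun y => ?_⟩
  have hδH : 0 ≤ δ * HH y := mul_nonneg hδ.le (HH_nonneg y)
  by_cases hy : 1 ≤ |y|
  · have : 0 ≤ ∫ z, κ z * DD y (ε * z) :=
      integral_nonneg_of_ae (Eventually.of_forall fun z => mul_nonneg (hκ0 z) (DD_out hy (ε * z)))
    linarith
  push Not at hy
  have hDint : Integrable (fun z => κ z * DD y (ε * z)) := by
    have h0 : Integrable κ := by simpa using hint 0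
    have h1 : Integrable (fun z => z * κ z) := by
      refine (hint 1).mono (by fun_prop) (Eventually.of_forall fun z => ?_)
      simp
    have hb : Integrable (fun z => κ z * HH (y + ε * z)) := by
      refine h0.mul_bdd (c := 1) ?_ (Eventually.of_forall fun z => ?_)
      · exact (HH_cont.comp (by fun_prop)).aestronglyMeasurable
      · rw [Real.norm_of_nonneg (HH_nonneg _)]; exact HH_le _
    refine ((hb.sub (h0.mul_const (HH y))).sub (h1.mul_const (ε * HH' y))).congr
      (Eventually.of_forall fun z => ?_)
    simp only [Pi.sub_apply, DD]; ring
  rcases lt_or_ge (9 / 10) y with h9 | h9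
  · have hle : ∫ z, (2 * ε ^ 2 * (κ z * (Iio (0:ℝ)).indicator (fun z => z ^ 2) z) - 4 * ε ^ 3 * (|z| ^ 3 * κ z))
        ≤ ∫ z, κ z * DD y (ε * z) := by
      refine integral_mono (((iI _ measurableSet_Iio).const_mul _).sub ((hint 3).const_mul _)) hDint (fun z => ?_)
      have := mul_le_mul_of_nonneg_left (DD_right h9.le (abs_lt.1 hy).2.le (ε * z)) (hκ0 z)
      refine le_trans (le_of_eq ?_) this
      have hiff : ε * z < 0 ↔ z < 0 := by
        constructor
        · intro h; by_contra h'; push Not at h'; nlinarith [mul_nonneg hε.le h']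
        · intro h; nlinarith
      simp only [hiff, indicator, mem_Iio, abs_mul, abs_of_pos hε]
      split_ifs <;> ring
    rw [integral_sub ((iI _ measurableSet_Iio).const_mul _) ((hint 3).const_mul _), integral_const_mul,
      integral_const_mul] at hle
    have : 0 ≤ ε ^ 2 * (2 * mL - 4 * ε * m3) := mul_nonneg (sq_nonneg _) (by linarith)
    nlinarith
  rcases lt_or_ge y (-(9 / 10)) with h9' | h9'
  · have hle : ∫ z, (2 * ε ^ 2 * (κ z * (Ioi (0:ℝ)).indicator (fun z => z ^ 2) z) - 4 * ε ^ 3 * (|z| ^ 3 * κ z))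
        ≤ ∫ z, κ z * DD y (ε * z) := by
      refine integral_mono (((iI _ measurableSet_Ioi).const_mul _).sub ((hint 3).const_mul _)) hDint (fun z => ?_)
      have := mul_le_mul_of_nonneg_left (DD_left (abs_lt.1 hy).1.le h9'.le (ε * z)) (hκ0 z)
      refine le_trans (le_of_eq ?_) this
      simp only [mul_pos_iff_of_pos_left hε, indicator, mem_Ioi, abs_mul, abs_of_pos hε]
      split_ifs <;> ring
    rw [integral_sub ((iI _ measurableSet_Ioi).const_mul _) ((hint 3).const_mul _), integral_const_mul,
      integral_const_mul] at hle
    have : 0 ≤ ε ^ 2 * (2 * mR - 4 * ε * m3) := mul_nonneg (sq_nonneg _) (by linarith)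
    nlinarith
  · have hle : ∫ z, (-(5 * ε ^ 2) * (z ^ 2 * κ z)) ≤ ∫ z, κ z * DD y (ε * z) := by
      refine integral_mono (hint2.const_mul _) hDint (fun z => ?_)
      have := mul_le_mul_of_nonneg_left (DD_int hy.le (ε * z)) (hκ0 z)
      refine le_trans (le_of_eq ?_) this
      ring
    rw [integral_const_mul] at hle
    have hH : 36 / 1000 ≤ HH y := by
      rw [(HH_in hy.le).1]
      have : y ^ 2 ≤ 81 / 100 := by nlinarith
      nlinarith
    have : δ * (36 / 1000) ≤ δ * HH y := by gcongr
    linarith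

lemma mom (k : ℝ → ℝ) (hk : H1 k) (hexp : EXPk k) (t : ℝ) :
    (∀ n : ℕ, Integrable (fun z => |z| ^ n * (exp (t * z) * k z))) ∧
    HasDerivAt (fun t => ∫ z, exp (t * z) * k z) (∫ z, z * (exp (t * z) * k z)) t := by
  have hkm : Measurable (fun z => (k z).toNNReal) := hk.1.continuous.measurable.real_toNNReal
  have hk0 := hk.2.1
  set ν := (volume : Measure ℝ).withDensity (fun z => ((k z).toNNReal : ENNReal)) with hν
  have hI : ∀ g : ℝ → ℝ, ∫ z, g z ∂ν = ∫ z, g z * k z := by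
    intro g
    rw [hν, integral_withDensity_eq_integral_smul hkm]
    congr 1; ext z
    rw [NNReal.smul_def, Real.coe_toNNReal _ (hk0 z), smul_eq_mul, mul_comm]
  have hJ : ∀ g : ℝ → ℝ, Integrable g ν ↔ Integrable (fun z => g z * k z) := by
    intro g
    rw [hν, integrable_withDensity_iff_integrable_smul hkm]
    have : (fun x => (k x).toNNReal • g x) = fun z => g z * k z := by
      ext z
      rw [NNReal.smul_def, Real.coe_toNNReal _ (hk0 z), smul_eq_mul, mul_comm]
    rw [this]
  have huniv : ∀ t, t ∈ interior (ProbabilityTheory.integrableExpSet (id : ℝ → ℝ) ν) := by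
    have : ProbabilityTheory.integrableExpSet (id : ℝ → ℝ) ν = univ := by
      ext t
      simp only [ProbabilityTheory.integrableExpSet, mem_univ, iff_true]
      exact (hJ _).2 (hexp t)
    intro t; rw [this]; simp
  constructor
  · intro n
    have := (hJ _).1 (ProbabilityTheory.integrable_pow_abs_mul_exp_of_mem_interior_integrableExpSet (huniv t) n)
    simpa [mul_assoc] using this
  · have := ProbabilityTheory.hasDerivAt_mgf (huniv t)
    have e : ProbabilityTheory.mgf (id : ℝ → ℝ) ν = fun t => ∫ z, exp (t * z) * k z := by
      ext t
      rw [ProbabilityTheory.mgf, hI]; rfl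
    rw [e, hI] at this
    simpa [mul_assoc] using this

lemma opt (k : ℝ → ℝ) (hk : H1 k) (hexp : EXPk k) (r c : ℝ) (hr : 0 < r) (hc0 : 0 < c)
    (hc : c < cstar k r) :
    ∃ t : ℝ, 0 < (∫ z, exp (t * z) * k z) - 1 + r + c * t ∧
      (∫ z, z * (exp (t * z) * k z)) = -c := by
  set M : ℝ → ℝ := fun t => ∫ z, exp (t * z) * k z with hM
  have hM0 : M 0 = 1 := by simp [hM, hk.2.2.2.1]
  have hMnn : ∀ t, 0 ≤ M t := fun t => integral_nonneg_of_ae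
    (Eventually.of_forall fun z => mul_nonneg (exp_pos _).le (hk.2.1 z))
  have hMsym : ∀ t, M (-t) = M t := by
    intro t
    simp only [hM]
    rw [← integral_neg_eq_self]
    congr 1; ext z
    rw [hk.2.2.1]; ring_nf
  have hbdd : BddBelow {y : ℝ | ∃ μ : ℝ, 0 < μ ∧ y = ((∫ z, Real.exp (-(μ * z)) * k z) - 1 + r) / μ} := by
    by_contra h
    have := Real.sInf_of_not_bddBelow h
    unfold cstar at hc
    linarith
  have hcs : ∀ μ, 0 < μ → cstar k r * μ ≤ M (-μ) - 1 + r := by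
    intro μ hμ
    rw [← le_div_iff₀ hμ]
    refine csInf_le hbdd ⟨μ, hμ, ?_⟩
    simp only [hM, neg_mul]
  set F : ℝ → ℝ := fun t => M t - 1 + r + c * t with hF
  have hFd : ∀ t, HasDerivAt F ((∫ z, z * (exp (t * z) * k z)) + c) t := by
    intro t
    have := (((mom k hk hexp t).2.sub_const 1).add_const r).add ((hasDerivAt_id t).const_mul c)
    exact this.congr_deriv (by simp)
  have hFc : Continuous F := continuous_iff_continuousAt.2 fun t => (hFd t).continuousAt
  have hFpos : ∀ t, 0 < F t := by
    intro t
    simp only [hF]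
    rcases lt_trichotomy t 0 with h | h | h
    · have := hcs (-t) (by linarith)
      rw [neg_neg] at this
      nlinarith
    · subst h; rw [hM0]; linarith
    · have := hcs t h
      rw [hMsym] at this
      nlinarith [mul_pos hc0 h]
  obtain ⟨t, ht⟩ : ∃ x, ∀ y, F x ≤ F y := by
    refine hFc.exists_forall_le_of_isBounded 0 ?_
    refine (Metric.isBounded_Icc (-(r / (cstar k r - c))) (1 / c)).subset ?_
    intro t ht
    have ht : F t ≤ F 0 := ht
    simp only [hF, hM0, mul_zero, add_zero] at ht
    have hd : 0 < cstar k r - c := by linarith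
    constructor
    · by_contra h
      push Not at h
      have h0 : t < 0 := h.trans_le (by simp; positivity)
      have h1 := hcs (-t) (by linarith)
      rw [neg_neg] at h1
      have h2 : r < (-t) * (cstar k r - c) := by rw [← div_lt_iff₀ hd]; linarith
      nlinarith
    · rw [le_div_iff₀ hc0]
      nlinarith [hMnn t]
  refine ⟨t, hFpos t, ?_⟩
  have hmin : IsLocalMin F t := Eventually.of_forall ht
  have := hmin.hasDerivAt_eq_zero (hFd t)
  linarith

lemma subsol (k : ℝ → ℝ) (hk : H1 k) (hexp : EXPk k) (r c : ℝ) (hr : 0 < r) (hc0 : 0 < c)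
    (hc : c < cstar k r) :
    ∃ l : ℝ, 0 < l ∧ l ≤ r ∧ ∃ R : ℝ, 0 < R ∧ ∃ u du : ℝ → ℝ, (∀ x, HasDerivAt u (du x) x) ∧
      Continuous du ∧ (∀ x, 0 ≤ u x) ∧ 0 < u 0 ∧ (∀ x, R ≤ |x| → u x = 0 ∧ du x = 0) ∧
      ∀ x, l * u x ≤ c * du x + ((∫ z, k z * u (x + z)) - u x) + r * u x := by
  obtain ⟨t, hpos, hder⟩ := opt k hk hexp r c hr hc0 hc
  set δ := (∫ z, exp (t * z) * k z) - 1 + r + c * t with hδ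
  have hkc := hk.1.continuous
  have hint := (mom k hk hexp t).1
  obtain ⟨ε, hε, htest⟩ := kernel_test (fun z => exp (t * z) * k z) (by fun_prop)
    (fun z => mul_nonneg (exp_pos _).le (hk.2.1 z)) (by simpa using hk.2.2.2.2.1) hint
    (δ - min (δ / 2) r) (by have := min_le_left (δ / 2) r; linarith)
  refine ⟨min (δ / 2) r, lt_min (by linarith) hr, min_le_right _ _, 1 / ε, by positivity,
    fun x => exp (t * x) * HH (ε * x), fun x => exp (t * x) * (t * HH (ε * x) + ε * HH' (ε * x)),
    ?_, ?_, ?_, ?_, ?_, ?_⟩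
  · intro x
    have h1 := ((hasDerivAt_id x).const_mul t).exp
    have h2 := (HH_deriv (ε * x)).comp x ((hasDerivAt_id x).const_mul ε)
    refine (h1.mul h2).congr_deriv ?_
    simp only [id, Function.comp]
    ring
  · have := HH_cont
    have := HH'_cont
    fun_prop
  · intro x
    exact mul_nonneg (exp_pos _).le (HH_nonneg _)
  · simp [HH]
  · intro x hx
    have : 1 ≤ |ε * x| := by
      rw [abs_mul, abs_of_pos hε]
      rw [div_le_iff₀ hε] at hx
      linarith
    simp [HH_out this]
  · intro x
    have h := htest (ε * x)
    set l := min (δ / 2) r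
    have h0 : Integrable (fun z => exp (t * z) * k z) := by simpa using hint 0
    have h1 : Integrable (fun z => z * (exp (t * z) * k z)) := by
      refine (hint 1).mono (by fun_prop) (Eventually.of_forall fun z => ?_)
      simp
    have hb : Integrable (fun z => exp (t * z) * k z * HH (ε * x + ε * z)) := by
      refine h0.mul_bdd (c := 1) ?_ (Eventually.of_forall fun z => ?_)
      · exact (HH_cont.comp (by fun_prop)).aestronglyMeasurable
      · rw [Real.norm_of_nonneg (HH_nonneg _)]; exact HH_le _
    have e1 : ∫ z, exp (t * z) * k z * DD (ε * x) (ε * z) =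
        (∫ z, exp (t * z) * k z * HH (ε * x + ε * z)) - (∫ z, exp (t * z) * k z) * HH (ε * x)
          - (∫ z, z * (exp (t * z) * k z)) * (ε * HH' (ε * x)) := by
      have hb2 : Integrable (fun z => exp (t * z) * k z * HH (ε * x + ε * z)
          - exp (t * z) * k z * HH (ε * x)) := hb.sub (h0.mul_const _)
      rw [← integral_mul_const, ← integral_mul_const, ← integral_sub hb (h0.mul_const _),
        ← integral_sub hb2 (h1.mul_const _)]
      congr 1; ext z
      simp only [DD]; ring
    have e2 : ∫ z, k z * (exp (t * (x + z)) * HH (ε * (x + z))) =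
        exp (t * x) * ∫ z, exp (t * z) * k z * HH (ε * x + ε * z) := by
      rw [← integral_const_mul]
      congr 1; ext z
      rw [mul_add t, exp_add, mul_add ε]; ring
    rw [e1, hder] at h
    rw [e2]
    have h3 := mul_nonneg (exp_pos (t * x)).le h
    rw [← sub_nonneg]
    refine h3.trans (le_of_eq ?_)
    rw [hδ]
    ring

section gen
variable {E : Type*} [NormedAddCommGroup E] [NormedSpace ℝ E]

lemma gen_norm0 (S K B : E →L[ℝ] E) (a m : ℝ) (ha : 0 < a) (hS : ‖S‖ ≤ 1 / a) (hK : ‖K‖ ≤ 1)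
    (hB : ‖B‖ ≤ m) (hlt : 1 + m < a) : ‖S * (K + B)‖ < 1 := by
  have h1 : ‖S * (K + B)‖ ≤ ‖S‖ * ‖K + B‖ := ContinuousLinearMap.opNorm_comp_le _ _
  have h2 : ‖K + B‖ ≤ 1 + m := (norm_add_le _ _).trans (by linarith)
  have h3 : ‖S‖ * ‖K + B‖ ≤ 1 / a * (1 + m) :=
    mul_le_mul hS h2 (norm_nonneg _) (by positivity)
  have h4 : 1 / a * (1 + m) < 1 := by
    rw [one_div, inv_mul_lt_iff₀ ha]; linarith
  linarith

lemma gen_norm1 (S K : E →L[ℝ] E) (a s : ℝ) (ha : 0 < a) (hS : ‖S‖ ≤ 1 / a) (hK : ‖K‖ ≤ 1)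
    (hs : 0 ≤ s) (hlt : 1 + s < a) : ‖S * K + s • S‖ < 1 := by
  have h1 : ‖S * K‖ ≤ ‖S‖ * ‖K‖ := ContinuousLinearMap.opNorm_comp_le _ _
  have h2 : ‖S * K + s • S‖ ≤ ‖S * K‖ + ‖s • S‖ := norm_add_le _ _
  have h5 : ‖s • S‖ = s * ‖S‖ := by rw [norm_smul, Real.norm_of_nonneg hs]
  have h3 : ‖S‖ * ‖K‖ ≤ 1 / a * 1 := mul_le_mul hS hK (norm_nonneg _) (by positivity)
  have h6 : s * ‖S‖ ≤ s * (1 / a) := mul_le_mul_of_nonneg_left hS hs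
  have h4 : 1 / a * (1 + s) < 1 := by
    rw [one_div, inv_mul_lt_iff₀ ha]; linarith
  linarith

lemma gen_sub (C : Set E) (S : E →L[ℝ] E) (hS : PosOp C S) (h u g : E) (hu : S h = u)
    (hg : g - h ∈ C) : S g - u ∈ C := by
  have := hS _ hg
  rwa [map_sub, hu] at this

end gen

def CC : Set EE := {f | ∀ x, 0 ≤ f x}

lemma CC_cone : IsCone CC where
  closed := by
    have : CC = ⋂ x : ℝ, {f : EE | 0 ≤ f x} := by
      ext f; simp only [mem_iInter]; rfl
    rw [this]
    exact isClosed_iInter fun x => isClosed_le continuous_const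
      (BoundedContinuousFunction.evalCLM ℝ x).continuous
  zero := fun x => le_refl _
  add := fun f hf g hg x => add_nonneg (hf x) (hg x)
  smul := fun d hd f hf x => mul_nonneg hd (hf x)

lemma CC_norm (A : EE →L[ℝ] EE) (hA : PosOp CC A) : ‖A‖ ≤ ‖A 1‖ := by
  refine ContinuousLinearMap.opNorm_le_bound _ (norm_nonneg _) (fun f => ?_)
  rw [BoundedContinuousFunction.norm_le (by positivity)]
  intro x
  have hb : ∀ y, |f y| ≤ ‖f‖ := fun y => f.norm_coe_le_norm y
  have h1 := hA (‖f‖ • 1 - f) (fun y => by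
    have := le_abs_self (f y); have := hb y; simp; linarith) x
  have h2 := hA (‖f‖ • 1 + f) (fun y => by
    have := neg_abs_le (f y); have := hb y; simp; linarith) x
  simp only [map_sub, map_add, map_smul, BoundedContinuousFunction.sub_apply,
    BoundedContinuousFunction.add_apply, BoundedContinuousFunction.smul_apply, smul_eq_mul] at h1 h2
  have h3 : A 1 x ≤ ‖A 1‖ := (le_abs_self _).trans ((A 1).norm_coe_le_norm x)
  have h4 : ‖f‖ * A 1 x ≤ ‖A 1‖ * ‖f‖ := by
    rw [mul_comm]; exact mul_le_mul_of_nonneg_right h3 (norm_nonneg _)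
  rw [Real.norm_eq_abs, abs_le]
  constructor <;> linarith

lemma avg_pos (w : ℝ → ℝ) (hw : Integrable w) (h : ∀ z, 0 ≤ w z) : PosOp CC (avg w hw) := by
  intro f hf x
  rw [avg_apply]
  exact integral_nonneg fun z => mul_nonneg (h z) (hf _)

lemma avg_norm_pos (w : ℝ → ℝ) (hw : Integrable w) (h : ∀ z, 0 ≤ w z) :
    ‖avg w hw‖ ≤ ∫ z, w z := by
  have := avg_norm w hw
  simpa only [abs_of_nonneg (h _)] using this

lemma avg_zero (w : ℝ → ℝ) (hw : Integrable w) (h : ∀ z, 0 ≤ w z) (f : EE) (hf : f ∈ CC) (x : ℝ)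
    (h0 : avg w hw f x = 0) (V : Set ℝ) (hV : IsOpen V) (hwV : ContinuousOn w V)
    (hpos : ∀ z ∈ V, 0 < w z) : ∀ z ∈ V, f (x + z) = 0 := by
  rw [avg_apply, integral_eq_zero_iff_of_nonneg (fun z => mul_nonneg (h z) (hf _))
    (avg_integrable hw f x)] at h0
  have h1 : (fun z => w z * f (x + z)) =ᵐ[volume.restrict V] fun _ => (0:ℝ) :=
    ae_restrict_of_ae h0
  have h2 := Measure.eqOn_open_of_ae_eq h1 hV
    (hwV.mul (f.continuous.comp (by fun_prop)).continuousOn) continuousOn_const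
  intro z hz
  have h3 := h2 hz
  have h4 := hpos z hz
  simp only [mul_eq_zero] at h3
  rcases h3 with h3 | h3
  · linarith
  · exact h3

lemma strict_pos (k : ℝ → ℝ) (hki : Integrable k) (hkc : Continuous k) (hk0 : ∀ z, 0 ≤ k z)
    (hk1 : 0 < k 0) (c γ : ℝ) (hc : 0 < c) (hγ : 0 < γ) (v g : EE) (hv : v ∈ CC)
    (hg : ∀ x, avg k hki v x ≤ g x) (hvg : v = avg (sw c γ) (sw_int c γ hγ) g)
    (hne : v ≠ 0) (x : ℝ) : 0 < v x := by
  obtain ⟨a, ha, hka⟩ : ∃ a > 0, ∀ z ∈ Metric.ball (0:ℝ) a, 0 < k z :=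
    Metric.eventually_nhds_iff_ball.1 (hkc.continuousAt.eventually (lt_mem_nhds hk1))
  have hgC : g ∈ CC := fun y => (avg_pos k hki hk0 v hv y).trans (hg y)
  have hloc : ∀ y, v y = 0 → ∀ z ∈ Metric.ball (0:ℝ) a, v (y + z) = 0 := by
    intro y hy
    rw [hvg] at hy
    have h1 := avg_zero (sw c γ) (sw_int c γ hγ) (sw_nonneg c γ hc) g hgC y hy (Ioi 0) isOpen_Ioi
      (by
        refine ContinuousOn.congr (f := fun z => (1 / c) * exp (-γ * z)) (by fun_prop) ?_
        intro z hz
        simp only [sw, indicator_of_mem hz])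
      (by
        intro z hz
        simp only [sw, indicator_of_mem hz]
        positivity)
    have h2 : g y = 0 := by
      have t1 : Tendsto (fun z => g (y + z)) (𝓝[>] 0) (𝓝 (g (y + 0))) := by
        have : Continuous fun z => g (y + z) := g.continuous.comp (by fun_prop)
        exact (this.tendsto 0).mono_left nhdsWithin_le_nhds
      have t2 : Tendsto (fun z => g (y + z)) (𝓝[>] 0) (𝓝 0) := by
        refine tendsto_const_nhds.congr' ?_
        filter_upwards [self_mem_nhdsWithin] with z hz
        exact (h1 z hz).symm
      have := tendsto_nhds_unique t1 t2
      simpa using this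
    have h3 : avg k hki v y = 0 :=
      le_antisymm (h2 ▸ hg y) (avg_pos k hki hk0 v hv y)
    exact avg_zero k hki hk0 v hv y h3 _ Metric.isOpen_ball hkc.continuousOn hka
  have hclop : IsClopen {y | v y = 0} := by
    refine ⟨isClosed_eq v.continuous continuous_const, Metric.isOpen_iff.2 fun y hy => ⟨a, ha, ?_⟩⟩
    intro w hw
    have := hloc y hy (w - y) (by
      rw [Metric.mem_ball, Real.dist_eq] at hw ⊢
      simpa using hw)
    simpa using this
  by_contra hx
  have hx0 : v x = 0 := le_antisymm (not_lt.1 hx) (hv x)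
  have := hclop.eq_univ ⟨x, hx0⟩
  apply hne
  ext y
  have hy : y ∈ {y | v y = 0} := by rw [this]; trivial
  exact hy

def mulop (b : EE) : EE →L[ℝ] EE := ContinuousLinearMap.mul ℝ EE b

lemma mulop_apply (b f : EE) : mulop b f = b * f := rfl

lemma mulop_norm (b : EE) : ‖mulop b‖ ≤ ‖b‖ := ContinuousLinearMap.opNorm_mul_apply_le ℝ EE b

lemma main_EE (k : ℝ → ℝ) (hki : Integrable k) (hk0 : ∀ z, 0 ≤ k z)
    (hk1 : ∫ z, k z = 1) (r q c l R R' : ℝ) (hr : 0 < r) (hq : 0 < q) (hc : 0 < c)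
    (hl : 0 < l) (hlr : l ≤ r) (hγ : 0 < (r + 2 + q) / c)
    (u : ℝ → ℝ) (du : ℝ → ℝ) (hu : ∀ x, HasDerivAt u (du x) x) (hduc : Continuous du)
    (hu0 : ∀ x, 0 ≤ u x) (hu00 : 0 < u 0) (huR : ∀ x, R ≤ |x| → u x = 0 ∧ du x = 0)
    (hsub : ∀ x, l * u x ≤ c * du x + ((∫ z, k z * u (x + z)) - u x) + r * u x)
    (b : EE) (hb0 : ∀ x, 0 ≤ b x) (hb1 : ∀ x, b x ≤ r + q) (hbR : ∀ x, |x| ≤ R → b x = r + q)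
    (hbR' : ∀ x, R' < |x| → b x = 0) :
    ∃ s, 0 ≤ s ∧ s ≤ r + 1 - l ∧ ∃ v ∈ CC, ‖v‖ = 1 ∧
      v = avg (sw c ((r + 2 + q) / c)) (sw_int _ _ hγ) (avg k hki v + mulop b v + s • v) := by
  set γ := (r + 2 + q) / c with hγd
  have hcγ : c * γ = r + 2 + q := by rw [hγd]; field_simp
  have huc : Continuous u := continuous_iff_continuousAt.2 fun x => (hu x).continuousAt
  have bdd : ∀ f : ℝ → ℝ, Continuous f → (∀ x, R ≤ |x| → f x = 0) → ∃ M, ∀ x, ‖f x‖ ≤ M := by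
    intro f hf h0
    obtain ⟨M, hM⟩ := (isCompact_Icc (a := -R) (b := R)).exists_bound_of_continuousOn hf.continuousOn
    refine ⟨max M 0, fun x => ?_⟩
    by_cases hx : R ≤ |x|
    · rw [h0 x hx]; simp
    · exact (hM x (abs_le.1 (not_le.1 hx).le)).trans (le_max_left _ _)
  obtain ⟨M1, hM1⟩ := bdd u huc fun x hx => (huR x hx).1
  have hhc : Continuous fun x => c * γ * u x - c * du x := by fun_prop
  obtain ⟨M2, hM2⟩ := bdd (fun x => c * γ * u x - c * du x) hhc fun x hx => by
    simp [(huR x hx).1, (huR x hx).2]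
  let U : EE := BoundedContinuousFunction.ofNormedAddCommGroup u huc M1 hM1
  let H : EE := BoundedContinuousFunction.ofNormedAddCommGroup _ hhc M2 hM2
  have hSU : avg (sw c γ) (sw_int c γ hγ) H = U := sw_inv c γ hc hγ U H du hu (fun x => rfl)
  have hSn : ‖avg (sw c γ) (sw_int c γ hγ)‖ ≤ 1 / (r + 2 + q) := by
    have := avg_norm_pos _ (sw_int c γ hγ) (sw_nonneg c γ hc)
    rwa [sw_integral c γ hγ, hcγ] at this
  have hKn : ‖avg k hki‖ ≤ 1 := hk1 ▸ avg_norm_pos k hki hk0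
  have hbn : ‖b‖ ≤ r + q := by
    rw [BoundedContinuousFunction.norm_le (by positivity)]
    intro x
    rw [Real.norm_of_nonneg (hb0 x)]; exact hb1 x
  have hSp := avg_pos _ (sw_int c γ hγ) (sw_nonneg c γ hc)
  have hKp := avg_pos k hki hk0
  have hUp : U ∈ CC := hu0
  refine eigen_abs CC_cone 1 (fun x => zero_le_one) ?_ CC_norm
    (avg (sw c γ) (sw_int c γ hγ)) (avg k hki) (mulop b) hSp hKp ?_ ?_ (r + 1 - l) (by linarith) ?_ ?_
    U ?_ ?_
  · rw [BoundedContinuousFunction.norm_le zero_le_one]; intro x; simp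
  · intro f hf x; exact mul_nonneg (hb0 x) (hf x)
  · exact gen_norm0 _ _ _ (r + 2 + q) (r + q) (by positivity) hSn hKn ((mulop_norm b).trans hbn) (by linarith)
  · intro s hs0 hs1
    exact gen_norm1 _ _ (r + 2 + q) s (by positivity) hSn hKn hs0 (by linarith)
  · intro f M hf
    exact compact_seq b R' hbR' c γ hc hγ f M hf
  · intro h
    have h1 : 0 ≤ -(u 0) := h 0
    linarith
  · refine gen_sub CC _ hSp H U _ hSU ?_
    intro x
    change 0 ≤ (∫ z, k z * u (x + z)) + b x * u x + (r + 1 - l) * u x - (c * γ * u x - c * du x)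
    rw [hcγ]
    by_cases hx : R ≤ |x|
    · rw [(huR x hx).1, (huR x hx).2]
      have : 0 ≤ ∫ z, k z * u (x + z) := hKp U hUp x
      linarith
    · rw [hbR x (not_le.1 hx).le]
      have := hsub x
      linarith

/-- Positive principal eigenvalue for large patches when `0 < c < c*`. -/
theorem positive_principal_eigenvalue_large_patch
    (k : ℝ → ℝ) (hk : H1 k) (hexp : EXPk k)
    (r q L0 : ℝ) (hr : 0 < r) (hq : 0 < q) (hL0 : 0 < L0)
    (ρ : ℝ → ℝ) (hρC : ContDiff ℝ 1 ρ) (hρrange : ∀ x, ρ x ∈ Set.Icc (0:ℝ) 1)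
    (hρ1 : ∀ x ≤ (0:ℝ), ρ x = 1) (hρ0 : ∀ x : ℝ, 1 ≤ x → ρ x = 0) (hρmono : Antitone ρ)
    (c : ℝ) (hc0 : 0 < c) (hc : c < cstar k r) :
    ∃ Lbar : ℝ, 0 < Lbar ∧ ∀ L, Lbar ≤ L →
      ∃ lam : ℝ, 0 < lam ∧ ∃ φ : ℝ → ℝ,
        ContDiff ℝ 1 φ ∧ (∀ ξ, 0 < φ ξ) ∧ (∃ C, ∀ ξ, φ ξ ≤ C) ∧
        ∀ ξ, c * deriv φ ξ + ((∫ η, k (η - ξ) * φ η) - φ ξ) +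
          (-q + (r + q) * ρ ((|ξ| - L) / L0)) * φ ξ = lam * φ ξ := by
  obtain ⟨hkC, hk0, hks, hk1, hk00, -⟩ := id hk
  obtain ⟨l, hl, hlr, R, hR, u, du, hu, hduc, hu0, hu00, huR, hsub⟩ := subsol k hk hexp r c hr hc0 hc
  have hki : Integrable k := by simpa using hexp 0
  refine ⟨R, hR, fun L hL => ?_⟩
  have hbc : Continuous fun ξ : ℝ => (r + q) * ρ ((|ξ| - L) / L0) := by
    have := hρC.continuous
    fun_prop
  have hb0 : ∀ ξ : ℝ, 0 ≤ (r + q) * ρ ((|ξ| - L) / L0) := fun ξ =>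
    mul_nonneg (by positivity) (hρrange _).1
  have hb1 : ∀ ξ : ℝ, (r + q) * ρ ((|ξ| - L) / L0) ≤ r + q := fun ξ =>
    mul_le_of_le_one_right (by positivity) (hρrange _).2
  let b : EE := BoundedContinuousFunction.ofNormedAddCommGroup _ hbc (r + q) (fun ξ => by
    rw [Real.norm_of_nonneg (hb0 ξ)]; exact hb1 ξ)
  have hγ : 0 < (r + 2 + q) / c := by positivity
  have hcγ : c * ((r + 2 + q) / c) = r + 2 + q := by field_simp
  obtain ⟨s, hs0, hs1, v, hv, hvn, hveq⟩ := main_EE k hki hk0 hk1 r q c l R (L + L0) hr hq hc0 hl hlr hγ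
    u du hu hduc hu0 hu00 huR hsub b hb0 hb1
    (by
      intro x hx
      change (r + q) * ρ ((|x| - L) / L0) = r + q
      rw [hρ1 _ (div_nonpos_of_nonpos_of_nonneg (by linarith) hL0.le), mul_one])
    (by
      intro x hx
      change (r + q) * ρ ((|x| - L) / L0) = 0
      rw [hρ0 _ (by rw [le_div_iff₀ hL0]; linarith), mul_zero])
  set g : EE := avg k hki v + mulop b v + s • v with hg
  have hgx : ∀ x, g x = avg k hki v x + (r + q) * ρ ((|x| - L) / L0) * v x + s * v x := fun x => rfl
  have hd : ∀ x, HasDerivAt v (((r + 2 + q) * v x - g x) / c) x := by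
    intro x
    have := sw_deriv c _ hc0 hγ g x
    rwa [← hveq, hcγ] at this
  refine ⟨r + 1 - s, by linarith, v, ?_, ?_, ⟨1, fun ξ => ?_⟩, fun ξ => ?_⟩
  · rw [contDiff_one_iff_deriv]
    refine ⟨fun x => (hd x).differentiableAt, ?_⟩
    have : deriv v = fun x => ((r + 2 + q) * v x - g x) / c := funext fun x => (hd x).deriv
    rw [this]
    have := g.continuous
    have := v.continuous
    fun_prop
  · refine strict_pos k hki hkC.continuous hk0 hk00 c _ hc0 hγ v g hv ?_ hveq ?_
    · intro x
      rw [hgx]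
      have h1 := mul_nonneg (hb0 x) (hv x)
      have h2 := mul_nonneg hs0 (hv x)
      linarith
    · intro h
      rw [h, norm_zero] at hvn
      exact zero_ne_one hvn
  · exact hvn ▸ (le_abs_self _).trans (EE.abs_le v ξ)
  · have hI : ∫ η, k (η - ξ) * v η = avg k hki v ξ := by
      rw [avg_apply, ← integral_add_left_eq_self (fun η => k (η - ξ) * v η) ξ]
      simp
    rw [hI, (hd ξ).deriv, hgx]
    field_simp
    ring
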